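/- For a fixed integer S ≥ 1, the map sending an odd positive divisor d of 2S (with e = 2S/d) to the pair (m, k) = ((max(d,e) + min(d,e) - 1)/2, (max(d,e) - min(d,e) - 1)/2) is a bijection from the set of odd positive divisors of 2S onto the set of pairs (m, k) of nonnegative integers satisfying S = T_m - T_k. -/

import Mathlib

/-- The triangular number `T m = m(m+1)/2`. -/
def T (m : ℕ) : ℕ := m * (m + 1) / 2

theorem two_mul_T (m : ℕ) : 2 * T m = m * (m + 1) :=
  Nat.mul_div_cancel' (Nat.even_mul_succ_self m).two_dvd

/-- Writing `m = k + b`, the difference of triangular numbers factors as `b (2k + b + 1) / 2`. -/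
theorem T_add_eq_T_add_iff (k b S : ℕ) :
    T k + S = T (k + b) ↔ b * (2 * k + b + 1) = 2 * S := by
  have hk := two_mul_T k
  have hm := two_mul_T (k + b)
  constructor <;> intro h <;> nlinarith

/-- The divisor complementary to an odd divisor of `2 * S` is even. -/
theorem exists_even_cofactor {S d : ℕ} (hpos : 0 < d) (hdvd : d ∣ 2 * S) (hodd : Odd d) :
    ∃ c, d * (2 * c) = 2 * S ∧ 2 * S / d = 2 * c := by
  obtain ⟨e, he⟩ := hdvd
  have heven : Even (d * e) := he ▸ even_two_mul S
  obtain ⟨c, rfl⟩ := ((Nat.even_mul.mp heven).resolve_left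
    (Nat.not_even_iff_odd.mpr hodd)).two_dvd
  exact ⟨c, he.symm, by rw [he, Nat.mul_div_cancel_left _ hpos]⟩

/-- For fixed `S ≥ 1`, the map sending an odd positive divisor `d` of `2S`
(with `e = 2S/d`) to the pair `(m, k) = ((max(d,e)+min(d,e)-1)/2, (max(d,e)-min(d,e)-1)/2)`
is a bijection from the odd positive divisors of `2S` onto the pairs `(m, k)` of
nonnegative integers with `S = T m - T k`. -/
theorem nyblom_bijection (S : ℕ) (hS : 1 ≤ S) :
    Set.BijOn
      (fun d : ℕ =>
        ((max d (2 * S / d) + min d (2 * S / d) - 1) / 2,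
         (max d (2 * S / d) - min d (2 * S / d) - 1) / 2))
      {d : ℕ | 0 < d ∧ d ∣ 2 * S ∧ Odd d}
      {p : ℕ × ℕ | T p.2 + S = T p.1} := by
  refine ⟨?_, ?_, ?_⟩
  · rintro d ⟨hpos, hdvd, hodd⟩
    obtain ⟨c, hc, hquot⟩ := exists_even_cofactor hpos hdvd hodd
    obtain ⟨a, rfl⟩ := hodd
    simp only [hquot, Set.mem_ofPred_eq]
    rcases le_or_gt c a with hca | hac
    · obtain ⟨k, rfl⟩ := Nat.exists_eq_add_of_le hca
      rw [max_eq_left (by omega), min_eq_right (by omega),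
        show (2 * (c + k) + 1 - 2 * c - 1) / 2 = k by omega,
        show (2 * (c + k) + 1 + 2 * c - 1) / 2 = k + 2 * c by omega, T_add_eq_T_add_iff]
      linarith
    · obtain ⟨k, rfl⟩ := Nat.exists_eq_add_of_lt hac
      rw [max_eq_right (by omega), min_eq_left (by omega),
        show (2 * (a + k + 1) - (2 * a + 1) - 1) / 2 = k by omega,
        show (2 * (a + k + 1) + (2 * a + 1) - 1) / 2 = k + (2 * a + 1) by omega,
        T_add_eq_T_add_iff]
      linarith
  · rintro d ⟨hpos, hdvd, hodd⟩ d' ⟨hpos', hdvd', hodd'⟩ h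
    obtain ⟨c, -, hquot⟩ := exists_even_cofactor hpos hdvd hodd
    obtain ⟨c', -, hquot'⟩ := exists_even_cofactor hpos' hdvd' hodd'
    obtain ⟨a, rfl⟩ := hodd
    obtain ⟨a', rfl⟩ := hodd'
    simp only [hquot, hquot', Prod.mk.injEq] at h
    omega
  · rintro ⟨m, k⟩ h
    simp only [Set.mem_ofPred_eq] at h
    have hkm : k ≤ m := by
      by_contra! hlt
      nlinarith [two_mul_T m, two_mul_T k]
    obtain ⟨b, rfl⟩ := Nat.exists_eq_add_of_le hkm
    rw [T_add_eq_T_add_iff] at h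
    rcases Nat.even_or_odd b with hb | hb
    · refine ⟨2 * k + b + 1, ⟨by omega, ⟨b, by rw [← h, mul_comm]⟩, by grind⟩, ?_⟩
      have hquot : 2 * S / (2 * k + b + 1) = b := by
        rw [← h, Nat.mul_div_cancel _ (by omega)]
      simp only [hquot, Prod.mk.injEq]
      omega
    · refine ⟨b, ⟨hb.pos, ⟨_, h.symm⟩, hb⟩, ?_⟩
      have hquot : 2 * S / b = 2 * k + b + 1 := by
        rw [← h, Nat.mul_div_cancel_left _ hb.pos]
      simp only [hquot, Prod.mk.injEq]
      omega
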